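/- Let A ∈ ℝ^{m×n} have rank r. If ‖E_j‖₂ < ε for all j = 2,…,k and M̃(ε) = [A, A+E₂, …, A+E_k], then for i = 1,…,r, |σ_i(M̃) − √k·σ_i(A)| ≤ ((k−1)ε/(√k·σ_i(A)))·(2‖A‖₂ + ε); in particular σ_i(M̃) → √k·σ_i(A) as ε → 0. -/

import Mathlib

open Matrix Finset

/-- Spectral (ℓ²-operator) norm of a matrix. -/
noncomputable def specNorm {m n : Type*} [Fintype m] [Fintype n] [DecidableEq n]
    (A : Matrix m n ℝ) : ℝ :=
  ‖LinearMap.toContinuousLinearMap (Matrix.toEuclideanLin A)‖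

/-- Eigenvalues of a real symmetric matrix, in nonincreasing order (0-based);
returns 0 if the matrix is not Hermitian. -/
noncomputable def eigDesc {n : ℕ} (A : Matrix (Fin n) (Fin n) ℝ) : Fin n → ℝ :=
  if hA : A.IsHermitian then
    fun i => hA.eigenvalues (Tuple.sort hA.eigenvalues i.rev)
  else fun _ => 0

/-- The `i`-th largest singular value (0-based), defined as the square root of the
`i`-th largest eigenvalue of `Aᵀ * A`; zero for out-of-range indices. -/
noncomputable def sval {m n : ℕ} (A : Matrix (Fin m) (Fin n) ℝ) (i : ℕ) : ℝ :=
  if h : i < n then Real.sqrt (eigDesc (Aᵀ * A) ⟨i, h⟩) else 0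

/-- Horizontal concatenation of `k` matrices of size `m × n`. -/
noncomputable def hconcat {m n k : ℕ} (A : Fin k → Matrix (Fin m) (Fin n) ℝ) :
    Matrix (Fin m) (Fin (k * n)) ℝ :=
  Matrix.of fun i j => A (finProdFinEquiv.symm j).1 i (finProdFinEquiv.symm j).2

open Module

theorem norm_sq_toEuclideanLin {m n : ℕ} (A : Matrix (Fin m) (Fin n) ℝ)
    (hA : (Aᵀ * A).IsHermitian) (x : EuclideanSpace ℝ (Fin n)) :
    ‖toEuclideanLin A x‖ ^ 2
      = ∑ j, hA.eigenvalues j * inner ℝ (hA.eigenvectorBasis j) x ^ 2 := by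
  have hx : (Aᵀ * A) *ᵥ x.ofLp = ∑ j, (hA.eigenvalues j * inner ℝ (hA.eigenvectorBasis j) x) •
      (hA.eigenvectorBasis j).ofLp := by
    conv_lhs => rw [← hA.eigenvectorBasis.sum_repr' x]
    rw [WithLp.ofLp_sum, Matrix.mulVec_sum]
    refine Finset.sum_congr rfl fun j _ => ?_
    rw [WithLp.ofLp_smul, Matrix.mulVec_smul, hA.mulVec_eigenvectorBasis, smul_smul, mul_comm]
  have h1 : ‖toEuclideanLin A x‖ ^ 2 = x.ofLp ⬝ᵥ ((Aᵀ * A) *ᵥ x.ofLp) := by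
    rw [EuclideanSpace.real_norm_sq_eq, ← Matrix.mulVec_mulVec, Matrix.dotProduct_mulVec,
      Matrix.vecMul_transpose]
    simp [dotProduct, sq, Matrix.toLpLin_apply]
  rw [h1, hx, dotProduct_sum]
  refine Finset.sum_congr rfl fun j _ => ?_
  rw [dotProduct_smul, EuclideanSpace.inner_eq_star_dotProduct]
  simp only [smul_eq_mul, star_trivial]
  ring

theorem inner_eq_zero_of_mem_span_image {ι F : Type*} [NormedAddCommGroup F]
    [InnerProductSpace ℝ F] {v : ι → F} (hv : Orthonormal ℝ v) {s : Set ι} {x : F}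
    (hx : x ∈ Submodule.span ℝ (v '' s)) {j : ι} (hj : j ∉ s) : inner ℝ (v j) x = 0 := by
  induction hx using Submodule.span_induction with
  | mem y hy =>
    obtain ⟨l, hl, rfl⟩ := hy
    exact hv.2 fun h => hj (h ▸ hl)
  | zero => simp
  | add y z _ _ hy hz => rw [inner_add_right, hy, hz, add_zero]
  | smul a y _ hy => rw [inner_smul_right, hy, mul_zero]

theorem finrank_span_image_finset {ι F : Type*} [NormedAddCommGroup F]
    [InnerProductSpace ℝ F] {v : ι → F} (hv : Orthonormal ℝ v) (s : Finset ι) :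
    finrank ℝ (Submodule.span ℝ (v '' (s : Set ι))) = s.card := by
  have h := finrank_span_eq_card (hv.linearIndependent.comp ((↑) : s → ι) Subtype.val_injective)
  rw [Set.range_comp, Subtype.range_coe_subtype] at h
  simpa using h

/-- Courant–Fischer: a singular value exceeds `c` iff `A` stretches some subspace of large enough
dimension by more than `c`. -/
theorem lt_sval_iff {m n : ℕ} (A : Matrix (Fin m) (Fin n) ℝ) (i : ℕ) {c : ℝ} (hc : 0 ≤ c) :
    c < sval A i ↔ ∃ V : Submodule ℝ (EuclideanSpace ℝ (Fin n)), i < finrank ℝ V ∧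
      ∀ x ∈ V, x ≠ 0 → c * ‖x‖ < ‖toEuclideanLin A x‖ := by
  have hA : (Aᵀ * A).IsHermitian := by
    simpa using Matrix.isHermitian_conjTranspose_mul_self A
  by_cases hi : i < n
  swap
  · have h0 : sval A i = 0 := by simp [sval, hi]
    rw [h0]
    refine ⟨fun h => absurd h (not_lt.mpr hc), ?_⟩
    rintro ⟨V, hV, -⟩
    have := Submodule.finrank_le V
    rw [finrank_euclideanSpace_fin] at this
    omega
  set b := hA.eigenvectorBasis
  set σ := Tuple.sort hA.eigenvalues
  have hmono : Monotone (hA.eigenvalues ∘ σ) := Tuple.monotone_sort _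
  have hs : sval A i = Real.sqrt (hA.eigenvalues (σ (Fin.rev ⟨i, hi⟩))) := by
    rw [sval, dif_pos hi, eigDesc, dif_pos hA]
  have hnorm (x : EuclideanSpace ℝ (Fin n)) : ‖x‖ ^ 2 = ∑ j, inner ℝ (b j) x ^ 2 := by
    rw [← b.sum_sq_norm_inner_right x]
    simp
  rw [hs, Real.lt_sqrt hc]
  constructor
  · intro h
    let s : Finset (Fin n) := (Finset.Ici (Fin.rev ⟨i, hi⟩)).map σ.toEmbedding
    refine ⟨Submodule.span ℝ (b '' (s : Set (Fin n))), ?_, fun x hx hx0 => ?_⟩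
    · rw [finrank_span_image_finset b.orthonormal, Finset.card_map, Fin.card_Ici, Fin.val_rev]
      simp only
      omega
    · refine lt_of_pow_lt_pow_left₀ 2 (norm_nonneg _) ?_
      have hlam : ∀ j ∈ s, c ^ 2 < hA.eigenvalues j := by
        intro j hj
        obtain ⟨l, hl, rfl⟩ := Finset.mem_map.mp hj
        exact h.trans_le (hmono (Finset.mem_Ici.mp hl))
      rw [mul_pow, hnorm, norm_sq_toEuclideanLin A hA, Finset.mul_sum]
      have hz : ∀ j ∉ s, inner ℝ (b j) x = 0 := fun j hj =>
        inner_eq_zero_of_mem_span_image b.orthonormal hx (by simpa using hj)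
      refine Finset.sum_lt_sum (fun j _ => ?_) ?_
      · by_cases hj : j ∈ s
        · exact mul_le_mul_of_nonneg_right (hlam j hj).le (sq_nonneg _)
        · simp [b, show inner ℝ (hA.eigenvectorBasis j) x = 0 from hz j hj]
      · obtain ⟨j, hj⟩ : ∃ j, inner ℝ (b j) x ≠ 0 := by
          by_contra! hall
          have := hnorm x
          simp only [hall] at this
          simp [hx0] at this
        have hjs : j ∈ s := by
          by_contra hjs
          exact hj (hz j hjs)
        exact ⟨j, Finset.mem_univ _, mul_lt_mul_of_pos_right (hlam j hjs) (by positivity)⟩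
  · rintro ⟨V, hV, hVc⟩
    by_contra! h
    let t : Finset (Fin n) := (Finset.Iic (Fin.rev ⟨i, hi⟩)).map σ.toEmbedding
    let U := Submodule.span ℝ (b '' (t : Set (Fin n)))
    have hU : finrank ℝ U = n - i := by
      rw [finrank_span_image_finset b.orthonormal, Finset.card_map, Fin.card_Iic, Fin.val_rev]
      simp only
      omega
    have hne : V ⊓ U ≠ ⊥ := by
      intro hbot
      have h1 := Submodule.finrank_sup_add_finrank_inf_eq V U
      have h2 := Submodule.finrank_le (V ⊔ U)
      rw [finrank_euclideanSpace_fin] at h2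
      rw [hbot, finrank_bot] at h1
      omega
    obtain ⟨x, ⟨hxV, hxU⟩, hx0⟩ := Submodule.exists_mem_ne_zero_of_ne_bot hne
    refine absurd (hVc x hxV hx0) (not_lt.mpr ?_)
    refine le_of_sq_le_sq ?_ (by positivity)
    rw [mul_pow, hnorm, norm_sq_toEuclideanLin A hA, Finset.mul_sum]
    refine Finset.sum_le_sum fun j _ => ?_
    by_cases hj : j ∈ t
    · obtain ⟨l, hl, rfl⟩ := Finset.mem_map.mp hj
      exact mul_le_mul_of_nonneg_right ((hmono (Finset.mem_Iic.mp hl)).trans h) (sq_nonneg _)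
    · have hz : inner ℝ (hA.eigenvectorBasis j) x = 0 :=
        inner_eq_zero_of_mem_span_image b.orthonormal hxU (by simpa using hj)
      simp [b, hz]

theorem sval_nonneg {m n : ℕ} (A : Matrix (Fin m) (Fin n) ℝ) (i : ℕ) : 0 ≤ sval A i := by
  unfold sval
  split_ifs
  exacts [Real.sqrt_nonneg _, le_rfl]

theorem norm_toEuclideanLin_le {m n : ℕ} (A : Matrix (Fin m) (Fin n) ℝ)
    (x : EuclideanSpace ℝ (Fin n)) : ‖toEuclideanLin A x‖ ≤ specNorm A * ‖x‖ :=
  (LinearMap.toContinuousLinearMap (toEuclideanLin A)).le_opNorm x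

theorem sval_pos {m n : ℕ} (A : Matrix (Fin m) (Fin n) ℝ) {i : ℕ} (hi : i < A.rank) :
    0 < sval A i := by
  obtain ⟨V, hV⟩ := Submodule.exists_isCompl (toEuclideanLin A).ker
  refine (lt_sval_iff A i le_rfl).mpr ⟨V, ?_, fun x hx hx0 => ?_⟩
  · have h1 := Submodule.finrank_add_eq_of_isCompl hV
    have h2 := (toEuclideanLin A).finrank_range_add_finrank_ker
    rw [Matrix.rank_eq_finrank_range_toLin A (EuclideanSpace.basisFun _ ℝ).toBasis
      (EuclideanSpace.basisFun _ ℝ).toBasis] at hi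
    rw [Matrix.toEuclideanLin_eq_toLin_orthonormal] at h1 h2
    omega
  · rw [zero_mul, norm_pos_iff]
    exact fun h => hx0 (Submodule.disjoint_def.mp hV.disjoint x h hx)

theorem sval_le_specNorm {m n : ℕ} (A : Matrix (Fin m) (Fin n) ℝ) (i : ℕ) :
    sval A i ≤ specNorm A := by
  by_contra! h
  obtain ⟨V, hV, hVc⟩ := (lt_sval_iff A i (norm_nonneg _)).mp h
  have hne : V ≠ ⊥ := by
    rintro rfl
    simp at hV
  obtain ⟨x, hxV, hx0⟩ := Submodule.exists_mem_ne_zero_of_ne_bot hne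
  exact absurd (hVc x hxV hx0) (not_lt.mpr (norm_toEuclideanLin_le A x))

/-- The `j`-th block of a vector of length `k * n`. -/
noncomputable def block (k n : ℕ) (j : Fin k) :
    EuclideanSpace ℝ (Fin (k * n)) →ₗ[ℝ] EuclideanSpace ℝ (Fin n) where
  toFun w := WithLp.toLp 2 fun a => w (finProdFinEquiv (j, a))
  map_add' _ _ := rfl
  map_smul' _ _ := rfl

/-- The vector of length `k * n` all of whose blocks are equal to a given one. -/
noncomputable def repeatBlock (k n : ℕ) :
    EuclideanSpace ℝ (Fin n) →ₗ[ℝ] EuclideanSpace ℝ (Fin (k * n)) where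
  toFun x := WithLp.toLp 2 fun a => x (finProdFinEquiv.symm a).2
  map_add' _ _ := rfl
  map_smul' _ _ := rfl

theorem block_apply {k n : ℕ} (j : Fin k) (w : EuclideanSpace ℝ (Fin (k * n))) (a : Fin n) :
    block k n j w a = w (finProdFinEquiv (j, a)) := rfl

theorem repeatBlock_apply {k n : ℕ} (x : EuclideanSpace ℝ (Fin n)) (a : Fin (k * n)) :
    repeatBlock k n x a = x (finProdFinEquiv.symm a).2 := rfl

theorem block_repeatBlock {k n : ℕ} (j : Fin k) (x : EuclideanSpace ℝ (Fin n)) :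
    block k n j (repeatBlock k n x) = x := by
  ext a
  rw [block_apply, repeatBlock_apply, Equiv.symm_apply_apply]

theorem sum_norm_sq_block {k n : ℕ} (w : EuclideanSpace ℝ (Fin (k * n))) :
    ∑ j, ‖block k n j w‖ ^ 2 = ‖w‖ ^ 2 := by
  simp only [EuclideanSpace.real_norm_sq_eq, block_apply]
  rw [← finProdFinEquiv.sum_comp, Fintype.sum_prod_type]

theorem norm_repeatBlock {k n : ℕ} (x : EuclideanSpace ℝ (Fin n)) :
    ‖repeatBlock k n x‖ = Real.sqrt k * ‖x‖ := by
  rw [← sq_eq_sq₀ (norm_nonneg _) (by positivity), ← sum_norm_sq_block, mul_pow,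
    Real.sq_sqrt (Nat.cast_nonneg k)]
  simp [block_repeatBlock]

theorem toEuclideanLin_hconcat {m n k : ℕ} (B : Fin k → Matrix (Fin m) (Fin n) ℝ)
    (w : EuclideanSpace ℝ (Fin (k * n))) :
    toEuclideanLin (hconcat B) w = ∑ j, toEuclideanLin (B j) (block k n j w) := by
  ext a
  rw [WithLp.ofLp_sum, Finset.sum_apply]
  simp only [Matrix.toLpLin_apply, mulVec, dotProduct, block_apply, hconcat]
  rw [← finProdFinEquiv.sum_comp, Fintype.sum_prod_type]
  simp [-finProdFinEquiv_symm_apply]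

theorem toEuclideanLin_hconcat_add {m n k : ℕ} (A : Matrix (Fin m) (Fin n) ℝ)
    (E : Fin k → Matrix (Fin m) (Fin n) ℝ) (w : EuclideanSpace ℝ (Fin (k * n))) :
    toEuclideanLin (hconcat fun j => A + E j) w
      = toEuclideanLin A (∑ j, block k n j w) + toEuclideanLin (hconcat E) w := by
  simp [toEuclideanLin_hconcat, Finset.sum_add_distrib]

theorem norm_sum_block_le {k n : ℕ} (w : EuclideanSpace ℝ (Fin (k * n))) :
    ‖∑ j, block k n j w‖ ≤ Real.sqrt k * ‖w‖ := by
  refine (norm_sum_le _ _).trans (le_of_sq_le_sq ?_ (by positivity))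
  rw [mul_pow, Real.sq_sqrt (Nat.cast_nonneg k), ← sum_norm_sq_block]
  simpa using sq_sum_le_card_mul_sum_sq (s := Finset.univ) (f := fun j => ‖block k n j w‖)

theorem norm_toEuclideanLin_hconcat_le {m n k : ℕ} (E : Fin k → Matrix (Fin m) (Fin n) ℝ)
    {ε : ℝ} (hε : 0 ≤ ε) (j₀ : Fin k) (hE0 : E j₀ = 0) (hE : ∀ j, specNorm (E j) ≤ ε)
    (w : EuclideanSpace ℝ (Fin (k * n))) :
    ‖toEuclideanLin (hconcat E) w‖ ≤ Real.sqrt (k - 1) * ε * ‖w‖ := by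
  have hk : (1 : ℝ) ≤ k := by exact_mod_cast j₀.pos
  have hcard : ((Finset.univ.erase j₀).card : ℝ) = k - 1 := by
    rw [Finset.card_erase_of_mem (Finset.mem_univ _), Finset.card_univ, Fintype.card_fin,
      Nat.cast_sub j₀.pos, Nat.cast_one]
  calc ‖toEuclideanLin (hconcat E) w‖
      = ‖∑ j ∈ Finset.univ.erase j₀, toEuclideanLin (E j) (block k n j w)‖ := by
        rw [toEuclideanLin_hconcat, ← Finset.add_sum_erase _ _ (Finset.mem_univ j₀), hE0]
        simp
    _ ≤ ∑ j ∈ Finset.univ.erase j₀, ε * ‖block k n j w‖ :=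
        norm_sum_le_of_le _ fun j _ => (norm_toEuclideanLin_le _ _).trans
          (mul_le_mul_of_nonneg_right (hE j) (norm_nonneg _))
    _ = ε * ∑ j ∈ Finset.univ.erase j₀, ‖block k n j w‖ := by rw [Finset.mul_sum]
    _ ≤ ε * (Real.sqrt (k - 1) * ‖w‖) := by
        refine mul_le_mul_of_nonneg_left (le_of_sq_le_sq ?_ (by positivity)) hε
        rw [mul_pow, Real.sq_sqrt (by linarith), ← sum_norm_sq_block, ← hcard]
        refine sq_sum_le_card_mul_sum_sq.trans (mul_le_mul_of_nonneg_left ?_ (Nat.cast_nonneg _))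
        exact Finset.sum_le_sum_of_subset_of_nonneg (Finset.erase_subset _ _)
          fun _ _ _ => sq_nonneg _
    _ = Real.sqrt (k - 1) * ε * ‖w‖ := by ring

theorem finrank_map_eq_of_ne_zero {F G : Type*} [AddCommGroup F] [Module ℝ F] [AddCommGroup G]
    [Module ℝ G] (f : F →ₗ[ℝ] G) (V : Submodule ℝ F) (h : ∀ x ∈ V, x ≠ 0 → f x ≠ 0) :
    finrank ℝ (V.map f) = finrank ℝ V := by
  rw [← LinearMap.range_domRestrict]
  refine LinearMap.finrank_range_of_inj (LinearMap.ker_eq_bot.mp ?_)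
  rw [LinearMap.ker_eq_bot']
  intro x hx
  by_contra hx0
  exact h x x.2 (by simpa using hx0) hx

/-- The Weyl perturbation inequality, relative to `k` copies of the same matrix. -/
theorem abs_sval_hconcat_sub_le {m n k : ℕ} (hk : 0 < k) (A : Matrix (Fin m) (Fin n) ℝ)
    (E : Fin k → Matrix (Fin m) (Fin n) ℝ) {δ : ℝ} (hδ : 0 ≤ δ)
    (hE : ∀ w, ‖toEuclideanLin (hconcat E) w‖ ≤ δ * ‖w‖) (i : ℕ) :
    |sval (hconcat fun j => A + E j) i - Real.sqrt k * sval A i| ≤ δ := by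
  have hsk : 0 < Real.sqrt k := Real.sqrt_pos.mpr (by exact_mod_cast hk)
  have hsq : Real.sqrt k * Real.sqrt k = k := Real.mul_self_sqrt (Nat.cast_nonneg k)
  have hsA := sval_nonneg A i
  have hsM := sval_nonneg (hconcat fun j => A + E j) i
  rw [abs_sub_le_iff]
  constructor
  · by_contra! h
    have hpos : 0 ≤ Real.sqrt k * sval A i := by positivity
    obtain ⟨W, hW, hWc⟩ := (lt_sval_iff (hconcat fun j => A + E j) i
      (c := δ + Real.sqrt k * sval A i) (by positivity)).mp (by linarith)
    let S : EuclideanSpace ℝ (Fin (k * n)) →ₗ[ℝ] EuclideanSpace ℝ (Fin n) := ∑ j, block k n j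
    have hS (w) : S w = ∑ j, block k n j w := by simp [S]
    have key : ∀ w ∈ W, w ≠ 0 → sval A i * ‖S w‖ < ‖toEuclideanLin A (S w)‖ := by
      intro w hw hw0
      have h1 := hWc w hw hw0
      rw [toEuclideanLin_hconcat_add, ← hS] at h1
      have h2 := norm_add_le (toEuclideanLin A (S w)) (toEuclideanLin (hconcat E) w)
      have h3 := mul_le_mul_of_nonneg_left (norm_sum_block_le w) hsA
      rw [← hS] at h3
      linarith [hE w]
    refine lt_irrefl _ ((lt_sval_iff A i hsA).mpr ⟨W.map S, ?_, ?_⟩)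
    · rwa [finrank_map_eq_of_ne_zero]
      intro w hw hw0 h0
      simpa [h0] using key w hw hw0
    · rintro _ ⟨w, hw, rfl⟩ hx0
      exact key w hw fun h => hx0 (by simp [h])
  · by_contra! h
    set t := sval (hconcat fun j => A + E j) i
    obtain ⟨V, hV, hVc⟩ := (lt_sval_iff A i (c := (δ + t) / Real.sqrt k) (by positivity)).mp
      (by rw [div_lt_iff₀ hsk]; linarith)
    refine lt_irrefl _ ((lt_sval_iff (hconcat fun j => A + E j) i hsM).mpr
      ⟨V.map (repeatBlock k n), ?_, ?_⟩)
    · rwa [finrank_map_eq_of_ne_zero]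
      intro x _ hx0 h0
      exact hx0 (by rw [← block_repeatBlock (⟨0, hk⟩ : Fin k) x, h0, map_zero])
    · rintro _ ⟨x, hx, rfl⟩ hx0
      have h1 := hVc x hx fun h => hx0 (by simp [h])
      rw [div_mul_eq_mul_div, div_lt_iff₀ hsk] at h1
      have h2 := hE (repeatBlock k n x)
      have h3 : toEuclideanLin A (∑ j, block k n j (repeatBlock k n x))
          = (k : ℝ) • toEuclideanLin A x := by
        simp [block_repeatBlock, ← Nat.cast_smul_eq_nsmul ℝ]
      have h4 := norm_sub_le (toEuclideanLin (hconcat fun j => A + E j) (repeatBlock k n x))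
        (toEuclideanLin (hconcat E) (repeatBlock k n x))
      rw [toEuclideanLin_hconcat_add, add_sub_cancel_right, h3, norm_smul, Real.norm_natCast,
        ← h3, ← toEuclideanLin_hconcat_add] at h4
      rw [norm_repeatBlock] at h2 ⊢
      have h5 := mul_lt_mul_of_pos_right h1 hsk
      rw [mul_assoc ‖_‖, hsq] at h5
      linarith

theorem stmt12 {m n k : ℕ} (hk : 2 ≤ k) (A : Matrix (Fin m) (Fin n) ℝ)
    (E : ℝ → Fin k → Matrix (Fin m) (Fin n) ℝ)
    (hE0 : ∀ ε, E ε ⟨0, by omega⟩ = 0)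
    (hE : ∀ ε > 0, ∀ j : Fin k, specNorm (E ε j) < ε)
    (i : ℕ) (hi : i < A.rank) :
    (∀ ε > 0,
      |sval (hconcat fun j => A + E ε j) i - Real.sqrt k * sval A i|
        ≤ ((k - 1) * ε / (Real.sqrt k * sval A i)) * (2 * specNorm A + ε)) ∧
    Filter.Tendsto (fun ε => sval (hconcat fun j => A + E ε j) i)
      (nhdsWithin 0 (Set.Ioi 0)) (nhds (Real.sqrt k * sval A i)) := by
  have hk' : (2 : ℝ) ≤ k := by exact_mod_cast hk
  have weyl : ∀ ε > 0, |sval (hconcat fun j => A + E ε j) i - Real.sqrt k * sval A i|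
      ≤ Real.sqrt (k - 1) * ε := fun ε hε =>
    abs_sval_hconcat_sub_le (by omega) A (E ε) (by positivity)
      (norm_toEuclideanLin_hconcat_le (E ε) hε.le _ (hE0 ε) fun j => (hE ε hε j).le) i
  constructor
  · intro ε hε
    refine (weyl ε hε).trans ?_
    have hpos := sval_pos A hi
    have hle := sval_le_specNorm A i
    have hsk : 0 < Real.sqrt k := Real.sqrt_pos.mpr (by linarith)
    have hp : Real.sqrt (k - 1) * Real.sqrt (k - 1) = k - 1 :=
      Real.mul_self_sqrt (by linarith)
    have hroot : Real.sqrt k ≤ Real.sqrt (k - 1) * 2 := by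
      refine Real.sqrt_le_iff.mpr ⟨by positivity, ?_⟩
      nlinarith
    rw [div_mul_eq_mul_div, le_div_iff₀ (by positivity)]
    calc Real.sqrt (k - 1) * ε * (Real.sqrt k * sval A i)
        ≤ Real.sqrt (k - 1) * ε * (Real.sqrt (k - 1) * 2 * sval A i) := by gcongr
      _ = (k - 1) * ε * (2 * sval A i) := by linear_combination (ε * 2 * sval A i) * hp
      _ ≤ (k - 1) * ε * (2 * specNorm A + ε) :=
        mul_le_mul_of_nonneg_left (by linarith) (mul_nonneg (by linarith) hε.le)
  · rw [tendsto_iff_norm_sub_tendsto_zero]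
    refine squeeze_zero' (Filter.Eventually.of_forall fun _ => norm_nonneg _)
      (Filter.eventually_of_mem self_mem_nhdsWithin weyl) ?_
    refine Filter.Tendsto.mono_left ?_ nhdsWithin_le_nhds
    have hcont : Continuous fun ε : ℝ => Real.sqrt (k - 1) * ε := by fun_prop
    simpa using hcont.tendsto 0
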